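/- Assume condition (L): p > 2, or p < 2 and α < δ. Then the function a ↦ L(a) = lim_{r→∞} r^α w(r,a) is continuous on all of ℝ, and the family of functions a ↦ (1+r)^α w(r,a), indexed by r ≥ 0, is equicontinuous on ℝ. -/

import Mathlib

open Set Filter Topology Asymptotics

/-- The p-Laplacian nonlinearity φ_p(x) = |x|^{p-2} x. -/
noncomputable def phiP (p x : ℝ) : ℝ := |x| ^ (p - 2) * x

/-- `w` is a solution of equation (E) on the interval `I ⊆ (0,∞)`:
`w` is C¹ on `I`, `|w'|^{p-2} w'` is C¹ on `I`, and the equation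
`(|w'|^{p-2}w')' + ((N-1)/r)|w'|^{p-2}w' + r w' + α w + |w|^{q-1} w = 0`
holds on `I` (derivatives taken within `I`). -/
def IsSolutionOn (N : ℕ) (p q α : ℝ) (w : ℝ → ℝ) (I : Set ℝ) : Prop :=
  ContDiffOn ℝ 1 w I ∧
  ContDiffOn ℝ 1 (fun r => phiP p (derivWithin w I r)) I ∧
  ∀ r ∈ I,
    derivWithin (fun s => phiP p (derivWithin w I s)) I r
      + ((N : ℝ) - 1) / r * phiP p (derivWithin w I r)
      + r * derivWithin w I r + α * w r + |w r| ^ (q - 1) * w r = 0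

/-- `w` is the global solution of (E) on `[0,∞)` with `w(0) = a`, `w'(0) = 0`:
`w ∈ C¹([0,∞))`, `|w'|^{p-2}w' ∈ C¹([0,∞))`, and (E) holds on `(0,∞)`. -/
def IsGlobalSolution (N : ℕ) (p q α a : ℝ) (w : ℝ → ℝ) : Prop :=
  ContDiffOn ℝ 1 w (Ici 0) ∧
  ContDiffOn ℝ 1 (fun r => phiP p (derivWithin w (Ici 0) r)) (Ici 0) ∧
  (∀ r ∈ Ioi (0 : ℝ),
    derivWithin (fun s => phiP p (derivWithin w (Ici 0) s)) (Ici 0) r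
      + ((N : ℝ) - 1) / r * phiP p (derivWithin w (Ici 0) r)
      + r * derivWithin w (Ici 0) r + α * w r + |w r| ^ (q - 1) * w r = 0) ∧
  w 0 = a ∧ derivWithin w (Ici 0) 0 = 0

/-- `r` is an isolated zero of `w` relative to the set `I`. -/
def IsIsolatedZeroOn (w : ℝ → ℝ) (I : Set ℝ) (r : ℝ) : Prop :=
  r ∈ I ∧ w r = 0 ∧ ∀ᶠ s in 𝓝[I \ {r}] r, w s ≠ 0

/-- `w` has at least `n` isolated zeros in `(0,∞)`. -/
def HasAtLeastIsolatedZeros (w : ℝ → ℝ) (n : ℕ) : Prop :=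
  ∃ z : Fin n → ℝ, StrictMono z ∧ ∀ i, 0 < z i ∧ IsIsolatedZeroOn w (Ici 0) (z i)

lemma phiP_zero (p : ℝ) : phiP p 0 = 0 := by simp [phiP]

lemma phiP_neg (p x : ℝ) : phiP p (-x) = -phiP p x := by simp [phiP]

lemma abs_phiP {p : ℝ} (hp : 1 < p) (x : ℝ) : |phiP p x| = |x| ^ (p - 1) := by
  rcases eq_or_ne x 0 with rfl | hx
  · simp [phiP, Real.zero_rpow (sub_pos.2 hp).ne']
  · have h := abs_pos.2 hx
    rw [phiP, abs_mul, abs_of_nonneg (by positivity), show p - 1 = p - 2 + 1 by ring,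
      Real.rpow_add_one h.ne']

lemma phiP_of_nonneg {p : ℝ} (hp : 1 < p) {x : ℝ} (hx : 0 ≤ x) : phiP p x = x ^ (p - 1) := by
  have h := abs_phiP hp x
  rwa [abs_of_nonneg (by unfold phiP; positivity), abs_of_nonneg hx] at h

lemma phiP_strictMono {p : ℝ} (hp : 1 < p) : StrictMono (phiP p) := by
  refine strictMono_of_odd_strictMonoOn_nonneg (phiP_neg p) fun x hx y hy hxy => ?_
  rw [phiP_of_nonneg hp hx, phiP_of_nonneg hp hy]
  exact Real.rpow_lt_rpow hx hxy (sub_pos.2 hp)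

lemma phiP_conj_phiP {p : ℝ} (hp : 1 < p) (x : ℝ) : phiP (p / (p - 1)) (phiP p x) = x := by
  rcases eq_or_ne x 0 with rfl | hx
  · simp [phiP_zero]
  · have h := abs_pos.2 hx
    have hp' : p - 1 ≠ 0 := (sub_pos.2 hp).ne'
    rw [phiP, abs_phiP hp, phiP, ← mul_assoc, ← Real.rpow_mul h.le, ← Real.rpow_add h]
    have : (p - 1) * (p / (p - 1) - 2) + (p - 2) = 0 := by field_simp; ring
    rw [this, Real.rpow_zero, one_mul]

lemma phiP_mul_self_nonneg (p x : ℝ) : 0 ≤ phiP p x * x := by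
  rw [phiP, mul_assoc]
  exact mul_nonneg (by positivity) (mul_self_nonneg x)

lemma hasDerivAt_phiP {p : ℝ} (hp : 2 < p) (x : ℝ) :
    HasDerivAt (phiP p) ((p - 1) * |x| ^ (p - 2)) x := by
  rcases eq_or_ne x 0 with rfl | hx
  · rw [hasDerivAt_iff_tendsto_slope]
    have h0 : p - 2 ≠ 0 := by linarith
    have h : Tendsto (fun x : ℝ => |x| ^ (p - 2)) (𝓝[≠] 0) (𝓝 ((p - 1) * |0| ^ (p - 2))) := by
      have hc : Continuous fun x : ℝ => |x| ^ (p - 2) :=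
        continuous_abs.rpow_const fun _ => Or.inr (by linarith)
      simpa [Real.zero_rpow h0] using (hc.tendsto 0).mono_left nhdsWithin_le_nhds
    refine h.congr' ?_
    filter_upwards [self_mem_nhdsWithin] with y hy
    have hy : y ≠ 0 := hy
    simp [slope_def_field, phiP, hy]
  · have h := abs_pos.2 hx
    have h1 := ((hasDerivAt_abs hx).rpow_const (p := p - 2) (Or.inl h.ne')).mul (hasDerivAt_id x)
    refine h1.congr_deriv ?_
    have h2 : SignType.sign x * x = |x| := sign_mul_self x
    have h3 : |x| ^ (p - 2) = |x| ^ (p - 2 - 1) * |x| := by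
      rw [← Real.rpow_add_one h.ne']; ring_nf
    simp only [id]
    rw [h3]
    linear_combination (p - 2) * |x| ^ (p - 2 - 1) * h2

lemma abs_phiP_sub_le {p : ℝ} (hp : 2 < p) {B x y : ℝ} (hx : |x| ≤ B) (hy : |y| ≤ B) :
    |phiP p x - phiP p y| ≤ (p - 1) * B ^ (p - 2) * |x - y| := by
  refine (convex_Icc (-B) B).norm_image_sub_le_of_norm_hasDerivWithin_le
    (f := phiP p) (fun z _ => (hasDerivAt_phiP hp z).hasDerivWithinAt) (fun z hz => ?_)
    (abs_le.1 hy) (abs_le.1 hx)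
  have hp1 : 0 ≤ p - 1 := by linarith
  rw [Real.norm_eq_abs, abs_mul, abs_of_nonneg hp1, abs_of_nonneg (by positivity)]
  gcongr
  exacts [abs_le.2 hz]

lemma abs_sub_le_of_abs_deriv_le {F F' G G' : ℝ → ℝ} {a b : ℝ} (hab : a ≤ b)
    (hF : ContinuousOn F (Icc a b)) (hG : ContinuousOn G (Icc a b))
    (hF' : ∀ s ∈ Ioo a b, HasDerivAt F (F' s) s) (hG' : ∀ s ∈ Ioo a b, HasDerivAt G (G' s) s)
    (h : ∀ s ∈ Ioo a b, |F' s| ≤ G' s) : |F b - F a| ≤ G b - G a := by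
  have key : ∀ e : ℝ, |e| ≤ 1 → e * (F b - F a) ≤ G b - G a := fun e he => by
    have hm : MonotoneOn (fun s => G s - e * F s) (Icc a b) := by
      refine monotoneOn_of_deriv_nonneg (convex_Icc a b) (hG.sub (hF.const_smul e)) ?_ ?_
      · rw [interior_Icc]
        exact fun s hs =>
          ((hG' s hs).sub ((hF' s hs).const_mul e)).differentiableAt.differentiableWithinAt
      · rw [interior_Icc]
        intro s hs
        have hd : HasDerivAt (fun s => G s - e * F s) (G' s - e * F' s) s :=
          (hG' s hs).sub ((hF' s hs).const_mul e)
        rw [hd.deriv, sub_nonneg]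
        calc e * F' s ≤ |e| * |F' s| := (le_abs_self _).trans_eq (abs_mul _ _)
          _ ≤ 1 * |F' s| := by gcongr
          _ ≤ G' s := by simpa using h s hs
    have := hm (left_mem_Icc.2 hab) (right_mem_Icc.2 hab) hab
    simp only at this
    linarith
  rw [abs_le]
  constructor
  · linarith [key (-1) (by simp)]
  · linarith [key 1 (by simp)]

lemma deriv_nonneg_of_forall_le_left {f : ℝ → ℝ} {f' c x : ℝ} (hcx : c < x)
    (hf : HasDerivAt f f' x) (h : ∀ s ∈ Icc c x, f s ≤ f x) : 0 ≤ f' := by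
  have ht := (hasDerivAt_iff_tendsto_slope.1 hf).mono_left
    (nhdsWithin_mono x (show Iio x ⊆ {x}ᶜ from fun y hy => ne_of_lt hy))
  refine ge_of_tendsto ht ?_
  filter_upwards [Ioo_mem_nhdsLT hcx] with s hs
  rw [slope_def_field]
  exact div_nonneg_of_nonpos (sub_nonpos.2 (h s ⟨hs.1.le, hs.2.le⟩)) (sub_nonpos.2 hs.2.le)

/-- `w` with derivative `y` is a radial solution on `(0,∞)` in dimension `n + 1`, and it starts at
height `a` with zero slope. -/
structure RadialSolution (n : ℕ) (p q α a : ℝ) (w y : ℝ → ℝ) : Prop where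
  init : w 0 = a
  init_deriv : y 0 = 0
  cont : ContinuousOn w (Ici 0)
  cont_deriv : ContinuousOn y (Ici 0)
  cont_flux : ContinuousOn (fun r => phiP p (y r)) (Ici 0)
  hasDerivAt : ∀ r, 0 < r → HasDerivAt w (y r) r
  hasDerivAt_flux : ∀ r, 0 < r → HasDerivAt (fun s => phiP p (y s))
    (-(n / r * phiP p (y r)) - r * y r - (α * w r + phiP (q + 1) (w r))) r

lemma IsGlobalSolution.radialSolution {n : ℕ} {p q α a : ℝ} {w : ℝ → ℝ}
    (h : IsGlobalSolution (n + 1) p q α a w) :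
    RadialSolution n p q α a w (derivWithin w (Ici 0)) := by
  obtain ⟨h1, h2, h3, h4, h5⟩ := h
  have hd : ∀ {f : ℝ → ℝ}, ContDiffOn ℝ 1 f (Ici 0) → ∀ r, 0 < r →
      HasDerivAt f (derivWithin f (Ici 0) r) r := fun hf r hr =>
    ((hf.differentiableOn one_ne_zero r hr.le).hasDerivWithinAt).hasDerivAt (Ici_mem_nhds hr)
  refine ⟨h4, h5, h1.continuousOn, h1.continuousOn_derivWithin (uniqueDiffOn_Ici 0) le_rfl,
    h2.continuousOn, hd h1, fun r hr => (hd h2 r hr).congr_deriv ?_⟩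
  have h := h3 r hr
  rw [phiP.eq_1 (q + 1), show q + 1 - 2 = q - 1 by ring]
  push_cast at h
  linear_combination h

namespace RadialSolution

variable {n : ℕ} {p q α a b : ℝ} {w y w₁ y₁ w₂ y₂ : ℝ → ℝ}

lemma neg (h : RadialSolution n p q α a w y) :
    RadialSolution n p q α (-a) (fun r => -w r) (fun r => -y r) where
  init := by rw [h.init]
  init_deriv := by rw [h.init_deriv, neg_zero]
  cont := h.cont.neg
  cont_deriv := h.cont_deriv.neg
  cont_flux := by
    simp only [phiP_neg]
    exact h.cont_flux.neg
  hasDerivAt r hr := (h.hasDerivAt r hr).neg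
  hasDerivAt_flux r hr := by
    simp only [phiP_neg]
    exact (h.hasDerivAt_flux r hr).neg.congr_deriv (by ring)

lemma energy_le (hp : 1 < p) (hq : 1 < q) (h : RadialSolution n p q α a w y)
    {r : ℝ} (hr : 0 ≤ r) :
    (p - 1) / p * |y r| ^ p + α / 2 * w r ^ 2 + |w r| ^ (q + 1) / (q + 1) ≤
      α / 2 * a ^ 2 + |a| ^ (q + 1) / (q + 1) := by
  have hp1 : 0 < p - 1 := sub_pos.2 hp
  have hp' : 1 < p / (p - 1) := by rw [one_lt_div hp1]; linarith
  set E : ℝ → ℝ := fun s =>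
    (p - 1) / p * |phiP p (y s)| ^ (p / (p - 1)) + α / 2 * w s ^ 2 + |w s| ^ (q + 1) / (q + 1)
  have hE : ∀ s, E s = (p - 1) / p * |y s| ^ p + α / 2 * w s ^ 2 + |w s| ^ (q + 1) / (q + 1) := by
    intro s
    simp only [E]
    rw [abs_phiP hp, ← Real.rpow_mul (abs_nonneg _), mul_div_cancel₀ _ hp1.ne']
  have hd : ∀ s, 0 < s → HasDerivAt E (-(n / s * (phiP p (y s) * y s)) - s * y s ^ 2) s := by
    intro s hs
    have h1 := ((hasDerivAt_abs_rpow (phiP p (y s)) hp').comp s (h.hasDerivAt_flux s hs)).const_mul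
      ((p - 1) / p)
    have h2 := ((h.hasDerivAt s hs).pow 2).const_mul (α / 2)
    have h3 := ((hasDerivAt_abs_rpow (w s) (show 1 < q + 1 by linarith)).comp s
      (h.hasDerivAt s hs)).div_const (q + 1)
    refine ((h1.add h2).add h3).congr_deriv ?_
    have h4 : |phiP p (y s)| ^ (p / (p - 1) - 2) * phiP p (y s) = y s := phiP_conj_phiP hp (y s)
    have h5 : |w s| ^ (q + 1 - 2) * w s = phiP (q + 1) (w s) := rfl
    have h6 : (p - 1) / p * (p / (p - 1)) = 1 := by
      field_simp
    rw [mul_assoc (p / (p - 1)), h4, mul_assoc (q + 1), h5]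
    have hq1 : q + 1 ≠ 0 := by linarith
    field_simp
    push_cast
    ring
  have hanti : AntitoneOn E (Ici 0) := by
    refine antitoneOn_of_deriv_nonpos (convex_Ici 0) ?_ ?_ ?_
    · refine (((h.cont_flux.abs.rpow_const fun _ _ => Or.inr (by linarith)).const_smul
        ((p - 1) / p)).add ((h.cont.pow 2).const_smul (α / 2))).add
        ((h.cont.abs.rpow_const fun _ _ => Or.inr (by linarith)).div_const _)
    · rw [interior_Ici]
      exact fun s hs => (hd s hs).differentiableAt.differentiableWithinAt
    · rw [interior_Ici]
      intro s hs
      have hs : 0 < s := hs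
      rw [(hd s hs).deriv]
      have h1 := phiP_mul_self_nonneg p (y s)
      have h2 : 0 ≤ n / s * (phiP p (y s) * y s) := by positivity
      have h3 : 0 ≤ s * y s ^ 2 := by positivity
      linarith
  have := hanti (self_mem_Ici) hr hr
  rw [hE, hE, h.init, h.init_deriv] at this
  simpa [Real.zero_rpow (show p ≠ 0 by linarith)] using this

lemma exists_forall_bound (n : ℕ) (hp : 1 < p) (hq : 1 < q) (hα : 0 < α) (A : ℝ) :
    ∃ B, 1 ≤ B ∧ ∀ a w y, |a| ≤ A → RadialSolution n p q α a w y →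
      ∀ r, 0 ≤ r → |w r| ≤ B ∧ |y r| ≤ B := by
  have hp1 : 0 < p - 1 := sub_pos.2 hp
  set C := α / 2 * A ^ 2 + |A| ^ (q + 1) / (q + 1)
  have hC : 0 ≤ C := by positivity
  refine ⟨1 + 2 / α * C + p / (p - 1) * C, by
    have : 0 ≤ 2 / α * C + p / (p - 1) * C := by positivity
    linarith, fun a w y ha h r hr => ?_⟩
  have hE := h.energy_le hp hq hr
  have haC : α / 2 * a ^ 2 + |a| ^ (q + 1) / (q + 1) ≤ C := by
    have h1 : a ^ 2 ≤ A ^ 2 := sq_le_sq' (by linarith [neg_abs_le a]) ((le_abs_self a).trans ha)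
    have h2 : |a| ≤ |A| := ha.trans (le_abs_self A)
    simp only [C]
    gcongr
  have e1 : 0 ≤ (p - 1) / p * |y r| ^ p := by positivity
  have e2 : 0 ≤ α / 2 * w r ^ 2 := by positivity
  have e3 : 0 ≤ |w r| ^ (q + 1) / (q + 1) := by positivity
  have hw : w r ^ 2 ≤ 2 / α * C := by
    have : w r ^ 2 = 2 / α * (α / 2 * w r ^ 2) := by field_simp
    rw [this]; gcongr; linarith
  have hy : |y r| ^ p ≤ p / (p - 1) * C := by
    have : |y r| ^ p = p / (p - 1) * ((p - 1) / p * |y r| ^ p) := by field_simp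
    rw [this]; gcongr; linarith
  have h1 : 0 ≤ 2 / α * C := by positivity
  have h2 : 0 ≤ p / (p - 1) * C := by positivity
  constructor
  · nlinarith [sq_abs (w r), sq_nonneg (|w r| - 1)]
  · rcases le_total |y r| 1 with h3 | h3
    · linarith
    · linarith [Real.self_le_rpow_of_one_le h3 hp.le]

lemma hasDerivAt_weighted_flux (h : RadialSolution n p q α a w y) {s : ℝ} (hs : 0 < s) :
    HasDerivAt (fun s => s ^ n * phiP p (y s))
      (-(s ^ n * (s * y s + (α * w s + phiP (q + 1) (w s))))) s := by
  refine ((hasDerivAt_pow n s).mul (h.hasDerivAt_flux s hs)).congr_deriv ?_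
  have h1 : (n : ℝ) * s ^ (n - 1) = s ^ n * (n / s) := by
    cases n with
    | zero => simp
    | succ k => rw [Nat.add_sub_cancel, pow_succ]; field_simp
  linear_combination phiP p (y s) * h1

lemma exists_flux_bounds (n : ℕ) (hp : 1 < p) (hq : 1 < q) (hα : 0 < α) (ha : 0 < a) :
    ∃ ρ c C : ℝ, 0 < ρ ∧ ρ ≤ 1 ∧ 0 < c ∧ ∀ b w y, |b - a| ≤ a / 2 →
      RadialSolution n p q α b w y → ∀ r, 0 < r → r ≤ ρ →
        c * r ≤ -phiP p (y r) ∧ -phiP p (y r) ≤ C * r := by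
  obtain ⟨B, hB1, hB⟩ := exists_forall_bound n hp hq hα (2 * a)
  have hB0 : 0 < B := by linarith
  set g : ℝ → ℝ := fun x => α * x + phiP (q + 1) x with hg
  have hgm : StrictMono g :=
    (strictMono_mul_left_of_pos hα).add (phiP_strictMono (show 1 < q + 1 by linarith))
  have hg0 : 0 < g (a / 4) := by
    have := hgm (show 0 < a / 4 by positivity)
    simpa [hg, phiP_zero] using this
  refine ⟨min 1 (min (a / (4 * B)) (g (a / 4) / (2 * B))), g (a / 4) / 2 / (n + 1),
    (B + g B) / (n + 1), by positivity, min_le_left _ _, by positivity, ?_⟩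
  intro b w y hb h r hr hrρ
  obtain ⟨hr1, hr2⟩ := le_min_iff.1 hrρ
  obtain ⟨hr2, hr3⟩ := le_min_iff.1 hr2
  rw [le_div_iff₀ (by positivity)] at hr2 hr3
  obtain ⟨hb1, hb2⟩ := abs_le.1 hb
  have hbd := hB b w y (abs_le.2 ⟨by linarith, by linarith⟩) h
  have hw : ∀ s, 0 < s → s ≤ r → a / 4 ≤ w s := by
    intro s hs hsr
    have := abs_sub_le_of_abs_deriv_le (F := w) (F' := y) (G := fun s => B * s)
      (G' := fun _ => B) hs.le (h.cont.mono Icc_subset_Ici_self) (by fun_prop)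
      (fun t ht => h.hasDerivAt t ht.1)
      (fun t _ => by simpa using (hasDerivAt_id t).const_mul B) (fun t ht => (hbd t ht.1.le).2)
    rw [h.init] at this
    have hsB : B * s ≤ B * r := by gcongr
    linarith [(abs_le.1 this).1]
  set c := g (a / 4) / 2 with hc
  set C := B + g B
  have hint : ∀ s, 0 < s → s ≤ r → c ≤ s * y s + g (w s) ∧ s * y s + g (w s) ≤ C := by
    intro s hs hsr
    obtain ⟨h1, h2⟩ := hbd s hs.le
    have h3 := hgm.monotone (hw s hs hsr)
    have h4 := hgm.monotone (abs_le.1 h1).2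
    have h5 : |s * y s| ≤ r * B := by
      rw [abs_mul, abs_of_pos hs]
      gcongr
    have h6 : r * B ≤ 1 * B := by gcongr
    constructor
    · linarith [(abs_le.1 h5).1]
    · linarith [(abs_le.1 h5).2]
  have key := abs_sub_le_of_abs_deriv_le (a := 0) (b := r)
    (F := fun s => s ^ n * phiP p (y s) + (c + C) / 2 * (s ^ (n + 1) / (n + 1)))
    (F' := fun s => -(s ^ n * (s * y s + g (w s))) + (c + C) / 2 * s ^ n)
    (G := fun s => (C - c) / 2 * (s ^ (n + 1) / (n + 1))) (G' := fun s => (C - c) / 2 * s ^ n)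
    hr.le
    (((continuous_pow n).continuousOn.mul (h.cont_flux.mono Icc_subset_Ici_self)).add
      (by fun_prop)) (by fun_prop)
    (fun s hs => (h.hasDerivAt_weighted_flux hs.1).add ?_)
    (fun s hs => ?_) (fun s hs => ?_)
  rotate_left
  · refine (((hasDerivAt_pow (n + 1) s).div_const _).const_mul _).congr_deriv ?_
    rw [Nat.add_sub_cancel]
    push_cast
    field_simp
  · refine (((hasDerivAt_pow (n + 1) s).div_const _).const_mul _).congr_deriv ?_
    rw [Nat.add_sub_cancel]
    push_cast
    field_simp
  · obtain ⟨h1, h2⟩ := hint s hs.1 hs.2.le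
    have hsn : 0 < s ^ n := pow_pos hs.1 n
    rw [show -(s ^ n * (s * y s + g (w s))) + (c + C) / 2 * s ^ n =
      s ^ n * ((c + C) / 2 - (s * y s + g (w s))) by ring, abs_mul, abs_of_pos hsn,
      mul_comm _ (s ^ n)]
    gcongr
    exact abs_le.2 ⟨by linarith, by linarith⟩
  have hrn : 0 < r ^ n := pow_pos hr n
  simp only [h.init_deriv, phiP_zero, ne_eq, Nat.succ_ne_zero, not_false_eq_true, zero_pow,
    mul_zero, zero_div, add_zero, sub_zero] at key
  rw [show r ^ n * phiP p (y r) + (c + C) / 2 * (r ^ (n + 1) / (n + 1)) =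
    r ^ n * (phiP p (y r) + (c + C) / 2 * (r / (n + 1))) by ring, abs_mul, abs_of_pos hrn,
    show (C - c) / 2 * (r ^ (n + 1) / (n + 1)) = r ^ n * ((C - c) / 2 * (r / (n + 1))) by ring]
    at key
  obtain ⟨k1, k2⟩ := abs_le.1 (le_of_mul_le_mul_left key hrn)
  rw [show c / (n + 1) * r = c * (r / (n + 1)) by ring,
    show C / (n + 1) * r = C * (r / (n + 1)) by ring]
  constructor <;> linarith

end RadialSolution

lemma exists_abs_rpow_sub_le {c : ℝ} (hc : 0 < c) (C σ : ℝ) :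
    ∃ K, 0 ≤ K ∧ ∀ x ∈ Icc c C, ∀ y ∈ Icc c C, |x ^ σ - y ^ σ| ≤ K * |x - y| := by
  have hne : ∀ x ∈ Icc c C, x ≠ 0 := fun x hx => (hc.trans_le hx.1).ne'
  obtain ⟨K, hK⟩ := isCompact_Icc.exists_bound_of_continuousOn
    (f := fun x : ℝ => σ * x ^ (σ - 1)) (s := Icc c C)
    (continuousOn_const.mul (continuousOn_id.rpow_const fun x hx => Or.inl (hne x hx)))
  refine ⟨|K|, abs_nonneg K, fun x hx y hy => ?_⟩
  exact (convex_Icc c C).norm_image_sub_le_of_norm_hasDerivWithin_le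
    (fun z hz => (Real.hasDerivAt_rpow_const (Or.inl (hne z hz))).hasDerivWithinAt)
    (fun z hz => (hK z hz).trans (le_abs_self K)) hy hx

namespace RadialSolution

variable {n : ℕ} {p q α a b : ℝ} {w y w₁ y₁ w₂ y₂ : ℝ → ℝ}

lemma flux_sub_bound {C₀ m l s : ℝ} (h₁ : RadialSolution n p q α a w₁ y₁)
    (h₂ : RadialSolution n p q α b w₂ y₂) (hC₀ : 0 ≤ C₀) (hl : 0 < l) (hs : 0 < s)
    (hg : ∀ t, 0 < t → t ≤ s →
      |(n + 1) * (w₁ t - w₂ t) - ((α * w₁ t + phiP (q + 1) (w₁ t)) -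
        (α * w₂ t + phiP (q + 1) (w₂ t)))| ≤ C₀ * |w₁ t - w₂ t|)
    (hm : ∀ t, 0 < t → t ≤ s → |w₁ t - w₂ t| ≤ m * Real.exp (l * t)) :
    |phiP p (y₁ s) - phiP p (y₂ s) + s * (w₁ s - w₂ s)| ≤
      C₀ * m / l * (Real.exp (l * s) - 1) := by
  have hsn : 0 < s ^ n := pow_pos hs n
  have key := abs_sub_le_of_abs_deriv_le (a := 0) (b := s)
    (F := fun t => t ^ n * phiP p (y₁ t) - t ^ n * phiP p (y₂ t) + t ^ (n + 1) * (w₁ t - w₂ t))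
    (F' := fun t => t ^ n * ((n + 1) * (w₁ t - w₂ t) - ((α * w₁ t + phiP (q + 1) (w₁ t)) -
        (α * w₂ t + phiP (q + 1) (w₂ t)))))
    (G := fun t => s ^ n * (C₀ * m / l * Real.exp (l * t)))
    (G' := fun t => s ^ n * (C₀ * (m * Real.exp (l * t)))) hs.le
    ((((continuous_pow n).continuousOn.mul (h₁.cont_flux.mono Icc_subset_Ici_self)).sub
      ((continuous_pow n).continuousOn.mul (h₂.cont_flux.mono Icc_subset_Ici_self))).add
      ((continuous_pow (n + 1)).continuousOn.mul
        ((h₁.cont.sub h₂.cont).mono Icc_subset_Ici_self)))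
    (by fun_prop) (fun t ht => ?_) (fun t ht => ?_) (fun t ht => ?_)
  · simp only [h₁.init_deriv, h₂.init_deriv, phiP_zero, ne_eq, Nat.succ_ne_zero,
      not_false_eq_true, zero_pow, mul_zero, zero_mul, sub_zero, add_zero, Real.exp_zero] at key
    rw [show s ^ n * phiP p (y₁ s) - s ^ n * phiP p (y₂ s) + s ^ (n + 1) * (w₁ s - w₂ s) =
      s ^ n * (phiP p (y₁ s) - phiP p (y₂ s) + s * (w₁ s - w₂ s)) by ring, abs_mul,
      abs_of_pos hsn, ← mul_sub, ← mul_sub] at key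
    exact le_of_mul_le_mul_left key hsn
  · refine (((h₁.hasDerivAt_weighted_flux ht.1).sub (h₂.hasDerivAt_weighted_flux ht.1)).add
      ((hasDerivAt_pow (n + 1) t).mul ((h₁.hasDerivAt t ht.1).sub
        (h₂.hasDerivAt t ht.1)))).congr_deriv ?_
    rw [Nat.add_sub_cancel]
    push_cast
    simp only [Pi.sub_apply]
    ring
  · have h1 : HasDerivAt (fun t => l * t) l t := by simpa using (hasDerivAt_id t).const_mul l
    refine ((h1.exp.const_mul (C₀ * m / l)).const_mul (s ^ n)).congr_deriv ?_
    field_simp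
  · rw [abs_mul, abs_of_pos (pow_pos ht.1 n)]
    have h1 := hm t ht.1 ht.2.le
    have h2 := ht.1.le
    have h3 := ht.2.le
    refine mul_le_mul (by gcongr) ((hg t ht.1 ht.2.le).trans (by gcongr)) (abs_nonneg _) hsn.le

/-- The damping term `r w'` forces the exponentially weighted distance of two solutions to be
maximal near the origin. -/
lemma argmax_weighted_sub_le {C₀ r₀ s : ℝ} (hp : 1 < p) (h₁ : RadialSolution n p q α a w₁ y₁)
    (h₂ : RadialSolution n p q α b w₂ y₂) (hC₀ : 0 < C₀) (hr₀ : 0 < r₀) (hs : 0 < s)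
    (hg : ∀ t, 0 < t → t ≤ s →
      |(n + 1) * (w₁ t - w₂ t) - ((α * w₁ t + phiP (q + 1) (w₁ t)) -
        (α * w₂ t + phiP (q + 1) (w₂ t)))| ≤ C₀ * |w₁ t - w₂ t|)
    (hne : w₁ s ≠ w₂ s)
    (hmax : ∀ t ∈ Icc 0 s, Real.exp (-(C₀ / r₀ * t)) * |w₁ t - w₂ t| ≤
      Real.exp (-(C₀ / r₀ * s)) * |w₁ s - w₂ s|) : s < r₀ := by
  set l := C₀ / r₀ with hl
  have hl0 : 0 < l := by positivity
  set D : ℝ → ℝ := fun t => w₁ t - w₂ t with hD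
  have hDs : 0 < |D s| := abs_pos.2 (sub_ne_zero.2 hne)
  set m := Real.exp (-(l * s)) * |D s| with hm
  have hm0 : 0 < m := by positivity
  have hbound : ∀ t, 0 < t → t ≤ s → |D t| ≤ m * Real.exp (l * t) := by
    intro t ht hts
    have := hmax t ⟨ht.le, hts⟩
    calc |D t| = Real.exp (-(l * t)) * |D t| * Real.exp (l * t) := by
          rw [mul_right_comm, ← Real.exp_add]; simp
      _ ≤ m * Real.exp (l * t) := by gcongr
  have hQ := flux_sub_bound h₁ h₂ hC₀.le hl0 hs hg hbound
  have hmD : m * Real.exp (l * s) = |D s| := by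
    rw [hm, mul_right_comm, ← Real.exp_add]; simp
  have hQ' : |phiP p (y₁ s) - phiP p (y₂ s) + s * D s| ≤ r₀ * |D s| := by
    refine hQ.trans ?_
    have : C₀ * m / l = r₀ * m := by rw [hl]; field_simp
    rw [this, mul_sub, mul_assoc, hmD]
    nlinarith
  have hder : HasDerivAt (fun t => Real.exp (-(2 * l * t)) * D t ^ 2)
      (Real.exp (-(2 * l * s)) * (2 * (D s * (y₁ s - y₂ s) - l * D s ^ 2))) s := by
    have h1 : HasDerivAt (fun t => -(2 * l * t)) (-(2 * l)) s := by
      exact ((hasDerivAt_id s).const_mul (2 * l)).neg.congr_deriv (by simp)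
    refine (h1.exp.mul (((h₁.hasDerivAt s hs).sub (h₂.hasDerivAt s hs)).pow 2)).congr_deriv ?_
    simp only [Pi.sub_apply, Pi.pow_apply, hD]
    push_cast
    ring
  have hsq : ∀ t, Real.exp (-(2 * l * t)) * D t ^ 2 = (Real.exp (-(l * t)) * |D t|) ^ 2 := by
    intro t
    rw [mul_pow, sq_abs, ← Real.exp_nat_mul]
    push_cast
    ring_nf
  have hnn := deriv_nonneg_of_forall_le_left hs hder fun t ht => by
    simp only [hsq]
    exact pow_le_pow_left₀ (by positivity) (hmax t ht) 2
  have hDy : 0 < D s * (y₁ s - y₂ s) := by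
    have h1 := nonneg_of_mul_nonneg_right hnn (Real.exp_pos _)
    have h2 : 0 < l * D s ^ 2 := mul_pos hl0 (by rw [← sq_abs]; positivity)
    linarith
  have hDv : 0 < D s * (phiP p (y₁ s) - phiP p (y₂ s)) := by
    rcases pos_and_pos_or_neg_and_neg_of_mul_pos hDy with ⟨h1, h2⟩ | ⟨h1, h2⟩
    · exact mul_pos h1 (sub_pos.2 (phiP_strictMono hp (sub_pos.1 h2)))
    · exact mul_pos_of_neg_of_neg h1 (sub_neg.2 (phiP_strictMono hp (sub_neg.1 h2)))
  have h1 : D s * (phiP p (y₁ s) - phiP p (y₂ s) + s * D s) ≤ |D s| * (r₀ * |D s|) :=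
    (le_abs_self _).trans (by rw [abs_mul]; gcongr)
  have h2 : s * (|D s| * |D s|) < r₀ * (|D s| * |D s|) := by
    have := abs_mul_abs_self (D s)
    nlinarith
  exact lt_of_mul_lt_mul_right h2 (by positivity)

lemma abs_deriv_sub_le {c C K M s : ℝ} (hp : 1 < p) (hs : 0 < s) (hs1 : s ≤ 1) (hK : 0 ≤ K)
    (hKσ : ∀ x ∈ Icc c C, ∀ y ∈ Icc c C,
      |x ^ (p / (p - 1) - 1) - y ^ (p / (p - 1) - 1)| ≤ K * |x - y|)
    (hc : 0 < c) {u v : ℝ} (hu : c * s ≤ -phiP p u ∧ -phiP p u ≤ C * s)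
    (hv : c * s ≤ -phiP p v ∧ -phiP p v ≤ C * s) (huv : |phiP p u - phiP p v| ≤ s * M) :
    |u - v| ≤ K * M := by
  have hp1 : 0 < p - 1 := sub_pos.2 hp
  have hp' : 1 < p / (p - 1) := by rw [one_lt_div hp1]; linarith
  set σ := p / (p - 1) - 1
  have hσ : 0 ≤ σ := by linarith
  have hM : 0 ≤ M := nonneg_of_mul_nonneg_right ((abs_nonneg _).trans huv) hs
  have hinv : ∀ z, c * s ≤ -phiP p z → z = -(s ^ σ * (-phiP p z / s) ^ σ) := by
    intro z hz
    have hz0 : 0 ≤ -phiP p z := (by positivity : 0 ≤ c * s).trans hz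
    rw [← Real.mul_rpow hs.le (by positivity), mul_div_cancel₀ _ hs.ne']
    conv_lhs => rw [← phiP_conj_phiP hp z, ← neg_neg (phiP p z), phiP_neg,
      phiP_of_nonneg hp' hz0]
  have hmem : ∀ z, c * s ≤ -phiP p z ∧ -phiP p z ≤ C * s → -phiP p z / s ∈ Icc c C :=
    fun z hz => ⟨(le_div_iff₀ hs).2 hz.1, (div_le_iff₀ hs).2 hz.2⟩
  have h1 := hKσ _ (hmem u hu) _ (hmem v hv)
  have h2 : |-phiP p u / s - -phiP p v / s| ≤ M := by
    rw [← sub_div, abs_div, abs_of_pos hs, div_le_iff₀ hs, abs_sub_comm,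
      show -phiP p v - -phiP p u = phiP p u - phiP p v by ring, mul_comm M]
    exact huv
  calc |u - v| = s ^ σ * |(-phiP p u / s) ^ σ - (-phiP p v / s) ^ σ| := by
        have h3 : u - v = -(s ^ σ * ((-phiP p u / s) ^ σ - (-phiP p v / s) ^ σ)) := by
          linear_combination hinv u hu.1 - hinv v hv.1
        rw [h3, abs_neg, abs_mul, abs_of_nonneg (by positivity)]
    _ ≤ 1 * (K * M) := by
        gcongr
        · exact Real.rpow_le_one hs.le hs1 hσ
        · exact h1.trans (by gcongr)
    _ = K * M := one_mul _

theorem exists_forall_abs_sub_le (n : ℕ) (hp : 1 < p) (hq : 1 < q) (hα : 0 < α) (ha : 0 < a)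
    {R : ℝ} (hR : 0 ≤ R) :
    ∃ C, ∀ b₁ b₂ w₁ y₁ w₂ y₂, |b₁ - a| ≤ a / 2 → |b₂ - a| ≤ a / 2 →
      RadialSolution n p q α b₁ w₁ y₁ → RadialSolution n p q α b₂ w₂ y₂ →
        ∀ r ∈ Icc 0 R, |w₁ r - w₂ r| ≤ C * |b₁ - b₂| := by
  obtain ⟨B, hB1, hB⟩ := exists_forall_bound n hp hq hα (2 * a)
  obtain ⟨ρ, c, C, hρ, hρ1, hc, hflux⟩ := exists_flux_bounds n hp hq hα ha
  obtain ⟨K, hK, hKσ⟩ := exists_abs_rpow_sub_le hc C (p / (p - 1) - 1)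
  set C₀ : ℝ := n + 1 + (α + q * B ^ (q - 1)) with hC₀
  have hC₀0 : 0 < C₀ := by positivity
  set F := Real.exp C₀
  have hF : 0 < F := Real.exp_pos _
  set r₀ := min ρ (1 / (2 * ((K + 1) * (C₀ + 1) * F))) with hr₀
  have hr₀0 : 0 < r₀ := by positivity
  set l := C₀ / r₀ with hl
  have hl0 : 0 < l := by positivity
  refine ⟨2 * Real.exp (l * R), fun b₁ b₂ w₁ y₁ w₂ y₂ hb₁ hb₂ h₁ h₂ => ?_⟩
  have hbd : ∀ {b w y}, |b - a| ≤ a / 2 → RadialSolution n p q α b w y →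
      ∀ r, 0 ≤ r → |w r| ≤ B := fun {b w y} hb h r hr => by
    obtain ⟨hb1, hb2⟩ := abs_le.1 hb
    exact (hB b w y (abs_le.2 ⟨by linarith, by linarith⟩) h r hr).1
  have hg : ∀ t, 0 < t → |(n + 1) * (w₁ t - w₂ t) - ((α * w₁ t + phiP (q + 1) (w₁ t)) -
        (α * w₂ t + phiP (q + 1) (w₂ t)))| ≤ C₀ * |w₁ t - w₂ t| := by
    intro t ht
    have h := abs_phiP_sub_le (show 2 < q + 1 by linarith) (hbd hb₁ h₁ t ht.le)
      (hbd hb₂ h₂ t ht.le)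
    rw [add_sub_cancel_right, show q + 1 - 2 = q - 1 by ring] at h
    have hn : (0 : ℝ) ≤ n + 1 := by positivity
    calc _ = |(n + 1) * (w₁ t - w₂ t) - (α * (w₁ t - w₂ t) +
          (phiP (q + 1) (w₁ t) - phiP (q + 1) (w₂ t)))| := by ring_nf
      _ ≤ |(n + 1) * (w₁ t - w₂ t)| + (|α * (w₁ t - w₂ t)| +
          |phiP (q + 1) (w₁ t) - phiP (q + 1) (w₂ t)|) :=
        (abs_sub _ _).trans (add_le_add_right (abs_add_le _ _) _)
      _ ≤ (n + 1) * |w₁ t - w₂ t| + (α * |w₁ t - w₂ t| + q * B ^ (q - 1) * |w₁ t - w₂ t|) := by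
        rw [abs_mul, abs_mul, abs_of_nonneg hn, abs_of_pos hα]
        gcongr
      _ = C₀ * |w₁ t - w₂ t| := by rw [hC₀]; ring
  have hcont : ContinuousOn (fun t => Real.exp (-(l * t)) * |w₁ t - w₂ t|) (Icc 0 R) :=
    (by fun_prop : Continuous fun t => Real.exp (-(l * t))).continuousOn.mul
      ((h₁.cont.sub h₂.cont).mono Icc_subset_Ici_self).abs
  obtain ⟨s, hs, hmax⟩ := isCompact_Icc.exists_isMaxOn (nonempty_Icc.2 hR) hcont
  set m := Real.exp (-(l * s)) * |w₁ s - w₂ s| with hm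
  have hbound : ∀ t ∈ Icc 0 R, |w₁ t - w₂ t| ≤ m * Real.exp (l * t) := by
    intro t ht
    calc |w₁ t - w₂ t| = Real.exp (-(l * t)) * |w₁ t - w₂ t| * Real.exp (l * t) := by
          rw [mul_right_comm, ← Real.exp_add]; simp
      _ ≤ m * Real.exp (l * t) := by gcongr; exact hmax ht
  have hm0 : 0 ≤ m := by positivity
  have h0 : |w₁ 0 - w₂ 0| = |b₁ - b₂| := by rw [h₁.init, h₂.init]
  suffices hm2 : m ≤ 2 * |b₁ - b₂| by
    intro r hr
    calc |w₁ r - w₂ r| ≤ m * Real.exp (l * r) := hbound r hr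
      _ ≤ 2 * |b₁ - b₂| * Real.exp (l * R) := by gcongr; exact hr.2
      _ = _ := by ring
  rcases hs.1.eq_or_lt with rfl | hs0
  · rw [hm, h0]
    simp only [mul_zero, neg_zero, Real.exp_zero, one_mul]
    linarith [abs_nonneg (b₁ - b₂)]
  rcases eq_or_ne (w₁ s) (w₂ s) with hne | hne
  · rw [hm, hne]; simp
  have hsr : s < r₀ := argmax_weighted_sub_le hp h₁ h₂ hC₀0 hr₀0 hs0 (fun t ht _ => hg t ht) hne
    fun t ht => hmax ⟨ht.1, ht.2.trans hs.2⟩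
  have hy : ∀ t ∈ Ioo 0 s, |y₁ t - y₂ t| ≤ K * ((C₀ + 1) * F * m) := by
    intro t ht
    have htR : ∀ t', 0 < t' → t' ≤ t → t' ∈ Icc 0 R := fun t' h1 h2 =>
      ⟨h1.le, h2.trans (ht.2.le.trans hs.2)⟩
    have htρ : t ≤ ρ := ht.2.le.trans (hsr.le.trans (min_le_left _ _))
    have hexp : Real.exp (l * t) ≤ F := by
      refine Real.exp_le_exp.2 ?_
      rw [hl, div_mul_eq_mul_div, div_le_iff₀ hr₀0]
      have := ht.2.le.trans hsr.le
      gcongr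
    have hexp2 : Real.exp (l * t) - 1 ≤ l * t * F := by
      have h1 := Real.add_one_le_exp (-(l * t))
      have h2 : Real.exp (-(l * t)) * Real.exp (l * t) = 1 := by rw [← Real.exp_add]; simp
      have h3 := Real.exp_pos (l * t)
      have h4 : 0 ≤ l * t := mul_nonneg hl0.le ht.1.le
      nlinarith
    have hQ := flux_sub_bound h₁ h₂ hC₀0.le hl0 ht.1 (fun t ht _ => hg t ht)
      fun t' h1 h2 => hbound t' (htR t' h1 h2)
    have hD := hbound t (htR t ht.1 le_rfl)
    refine abs_deriv_sub_le hp ht.1 (htρ.trans hρ1) hK hKσ hc (hflux _ _ _ hb₁ h₁ t ht.1 htρ)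
      (hflux _ _ _ hb₂ h₂ t ht.1 htρ) ?_
    calc |phiP p (y₁ t) - phiP p (y₂ t)|
        = |(phiP p (y₁ t) - phiP p (y₂ t) + t * (w₁ t - w₂ t)) - t * (w₁ t - w₂ t)| := by ring_nf
      _ ≤ C₀ * m / l * (l * t * F) + t * (m * F) := by
        refine (abs_sub _ _).trans (add_le_add (hQ.trans (by gcongr)) ?_)
        rw [abs_mul, abs_of_pos ht.1]
        have := ht.1.le
        gcongr
        exact hD.trans (by gcongr)
      _ = t * ((C₀ + 1) * F * m) := by field_simp
  have hD := abs_sub_le_of_abs_deriv_le (F := fun t => w₁ t - w₂ t) (F' := fun t => y₁ t - y₂ t)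
    (G := fun t => K * ((C₀ + 1) * F * m) * t) (G' := fun _ => K * ((C₀ + 1) * F * m)) hs0.le
    ((h₁.cont.sub h₂.cont).mono Icc_subset_Ici_self) (by fun_prop)
    (fun t ht => (h₁.hasDerivAt t ht.1).sub (h₂.hasDerivAt t ht.1))
    (fun t _ => by simpa using (hasDerivAt_id t).const_mul (K * ((C₀ + 1) * F * m))) hy
  have hsmall : K * ((C₀ + 1) * F * m) * s ≤ m / 2 := by
    have h1 : s ≤ 1 / (2 * ((K + 1) * (C₀ + 1) * F)) := hsr.le.trans (min_le_right _ _)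
    calc K * ((C₀ + 1) * F * m) * s
        ≤ (K + 1) * ((C₀ + 1) * F * m) * (1 / (2 * ((K + 1) * (C₀ + 1) * F))) := by
          gcongr; linarith
      _ = m / 2 := by field_simp
  have hm1 : m ≤ |w₁ s - w₂ s| :=
    mul_le_of_le_one_left (abs_nonneg _) (Real.exp_le_one_iff.2 (by
      have := mul_pos hl0 hs0
      linarith))
  have h3 := abs_sub_abs_le_abs_sub (w₁ s - w₂ s) (w₁ 0 - w₂ 0)
  simp only [mul_zero, sub_zero] at hD
  rw [h0] at h3
  linarith

/-- Continuous dependence on the initial height, uniformly on bounded intervals. -/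
theorem eventually_forall_abs_sub_le {w y : ℝ → ℝ → ℝ} (hp : 1 < p) (hq : 1 < q) (hα : 0 < α)
    (h : ∀ a, RadialSolution n p q α a (w a) (y a)) (a : ℝ) {R ε : ℝ} (hR : 0 ≤ R) (hε : 0 < ε) :
    ∀ᶠ b in 𝓝 a, ∀ r ∈ Icc 0 R, |w a r - w b r| ≤ ε := by
  have pos : ∀ {w y : ℝ → ℝ → ℝ} {a : ℝ}, (∀ a, RadialSolution n p q α a (w a) (y a)) → 0 < a →
      ∀ᶠ b in 𝓝 a, ∀ r ∈ Icc 0 R, |w a r - w b r| ≤ ε := by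
    intro w y a h ha
    obtain ⟨C, hC⟩ := exists_forall_abs_sub_le n hp hq hα ha hR
    have ht : Tendsto (fun b => C * |a - b|) (𝓝 a) (𝓝 0) := by
      have hc : Continuous fun b => C * |a - b| := by fun_prop
      simpa using hc.tendsto a
    filter_upwards [ht.eventually_lt_const hε, Metric.closedBall_mem_nhds a (half_pos ha)]
      with b hb hba r hr
    exact (hC a b _ _ _ _ (by simpa using (half_pos ha).le) hba (h a) (h b) r hr).trans hb.le
  rcases lt_trichotomy a 0 with ha | rfl | ha
  · have := pos (w := fun a r => -w (-a) r) (y := fun a r => -y (-a) r)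
      (fun a => by simpa using (h (-a)).neg) (neg_pos.2 ha)
    rw [nhds_neg] at this
    filter_upwards [this] with b hb r hr
    have := hb r hr
    simp only [neg_neg] at this
    rwa [show w a r - w b r = -(-w a r - -w b r) by ring, abs_neg]
  · have ht : Tendsto (fun b : ℝ => b ^ 2 + 2 / α * (|b| ^ (q + 1) / (q + 1))) (𝓝 0) (𝓝 0) := by
      have hc : Continuous fun b : ℝ => b ^ 2 + 2 / α * (|b| ^ (q + 1) / (q + 1)) :=
        (continuous_pow 2).add (((continuous_abs.rpow_const fun _ =>
          Or.inr (by linarith)).div_const _).const_mul _)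
      simpa [Real.zero_rpow (show q + 1 ≠ 0 by linarith)] using hc.tendsto 0
    have key : ∀ b r, 0 ≤ r → w b r ^ 2 ≤ b ^ 2 + 2 / α * (|b| ^ (q + 1) / (q + 1)) := by
      intro b r hr
      have hE := (h b).energy_le hp hq hr
      have hp1 : 0 < p - 1 := sub_pos.2 hp
      have e1 : 0 ≤ (p - 1) / p * |y b r| ^ p := by positivity
      have e3 : 0 ≤ |w b r| ^ (q + 1) / (q + 1) := by positivity
      have : w b r ^ 2 = 2 / α * (α / 2 * w b r ^ 2) := by field_simp
      rw [this, show b ^ 2 = 2 / α * (α / 2 * b ^ 2) by field_simp, ← mul_add]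
      gcongr
      linarith
    filter_upwards [ht.eventually_lt_const (show (0 : ℝ) < ε ^ 2 by positivity)] with b hb r hr
    have h0 : w 0 r = 0 := by
      have := key 0 r hr.1
      rw [abs_zero, Real.zero_rpow (by linarith)] at this
      have h2 := sq_nonneg (w 0 r)
      refine pow_eq_zero_iff two_ne_zero |>.1 (le_antisymm (by simpa using this) h2)
    rw [h0, zero_sub, abs_neg]
    exact abs_le_of_sq_le_sq ((key b r hr.1).trans hb.le) hε.le
  · exact pos h ha

end RadialSolution

lemma exists_flux_decay {p α : ℝ} (hp : 1 < p)
    (hL : 2 < p ∨ (p < 2 ∧ α < p / (2 - p))) {B : ℝ} (hB : 1 ≤ B) :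
    ∃ η θ : ℝ, 0 < η ∧ 0 < θ ∧ ∀ s k x : ℝ, 1 ≤ s → |x| ≤ B → s ^ (α + 1) * |x| ≤ k →
      s ^ (α - 1) * |phiP p x| ≤ θ * s ^ (-η) * (k + 1) := by
  rcases hL with h2 | ⟨h2, hlt⟩
  · refine ⟨2, B ^ (p - 2), two_pos, by positivity, fun s k x hs hx hk => ?_⟩
    have hs0 : 0 < s := by linarith
    have hk0 : 0 ≤ k := le_trans (by positivity) hk
    rw [phiP, abs_mul, abs_of_nonneg (show 0 ≤ |x| ^ (p - 2) by positivity)]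
    calc s ^ (α - 1) * (|x| ^ (p - 2) * |x|)
        = |x| ^ (p - 2) * s ^ (-2 : ℝ) * (s ^ (α + 1) * |x|) := by
          rw [show α - 1 = -2 + (α + 1) by ring, Real.rpow_add hs0]; ring
      _ ≤ B ^ (p - 2) * s ^ (-2 : ℝ) * (k + 1) := by
          gcongr
          linarith
  · rw [lt_div_iff₀ (by linarith)] at hlt
    refine ⟨2 - (α + 1) * (2 - p), 1, by linarith, one_pos, fun s k x hs hx hk => ?_⟩
    have hs0 : 0 < s := by linarith
    have hk0 : 0 ≤ k := le_trans (by positivity) hk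
    have hp1 : 0 < p - 1 := sub_pos.2 hp
    have hle : k ^ (p - 1) ≤ k + 1 := by
      rcases le_total k 1 with h | h
      · linarith [Real.rpow_le_one hk0 h hp1.le]
      · have := Real.rpow_le_rpow_of_exponent_le h (show p - 1 ≤ 1 by linarith)
        rw [Real.rpow_one] at this
        linarith
    rw [abs_phiP hp]
    calc s ^ (α - 1) * |x| ^ (p - 1)
        = 1 * s ^ (-(2 - (α + 1) * (2 - p))) * (s ^ (α + 1) * |x|) ^ (p - 1) := by
          rw [Real.mul_rpow (by positivity) (abs_nonneg x), ← Real.rpow_mul hs0.le, one_mul,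
            ← mul_assoc, ← Real.rpow_add hs0]
          ring_nf
      _ ≤ 1 * s ^ (-(2 - (α + 1) * (2 - p))) * (k + 1) := by
          gcongr
          exact (Real.rpow_le_rpow (by positivity) hk hp1.le).trans hle

namespace RadialSolution

variable {n : ℕ} {p q α a : ℝ} {w y : ℝ → ℝ}

lemma weighted_deriv_le {R T B C m η θ : ℝ} (hp : 1 < p) (hα : 0 < α) (hR : 1 ≤ R) (hC : 0 ≤ C)
    (hη : 0 < η) (hθ : 0 < θ) (h : RadialSolution n p q α a w y) (hB : ∀ s, 0 ≤ s → |y s| ≤ B)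
    (hg : ∀ s, 0 ≤ s → |α * w s + phiP (q + 1) (w s)| ≤ C * |w s|)
    (hflux : ∀ s k x : ℝ, 1 ≤ s → |x| ≤ B → s ^ (α + 1) * |x| ≤ k →
      s ^ (α - 1) * |phiP p x| ≤ θ * s ^ (-η) * (k + 1))
    (hRθ : (α + 1) * (p - 1) * θ * R ^ (-η) ≤ 1 / 2)
    (hm : ∀ s ∈ Icc R T, s ^ α * |w s| ≤ m) :
    ∀ s ∈ Icc R T, s ^ (α + 1) * |y s| ≤ 2 * C * m + B * R ^ (α + 1) + 1 := by
  intro s₀ hs₀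
  have hRT : R ≤ T := hs₀.1.trans hs₀.2
  have hp1 : 0 < p - 1 := sub_pos.2 hp
  have hcont : ContinuousOn (fun s => s ^ (α + 1) * |y s|) (Icc R T) :=
    ((continuous_id.rpow_const fun _ => Or.inr (by linarith)).continuousOn).mul
      (h.cont_deriv.mono fun s hs => (show (0 : ℝ) ≤ R by linarith).trans hs.1).abs
  obtain ⟨s, hs, hmax⟩ := isCompact_Icc.exists_isMaxOn (nonempty_Icc.2 hRT) hcont
  refine (hmax hs₀).trans ?_
  have hs1 : 1 ≤ s := hR.trans hs.1
  have hs0 : 0 < s := by linarith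
  have hm0 : 0 ≤ m := le_trans (by positivity) (hm s hs)
  have hB0 : 0 ≤ B := (abs_nonneg _).trans (hB 0 le_rfl)
  rcases hs.1.eq_or_lt with rfl | hRs
  · have h1 : R ^ (α + 1) * |y R| ≤ B * R ^ (α + 1) := by
      rw [mul_comm]; gcongr; exact hB R hs0.le
    have : 0 ≤ 2 * C * m := by positivity
    simp only
    linarith
  set γ := (α + 1) * (p - 1) with hγ
  set v := fun s => phiP p (y s) with hv
  have heq : ∀ t ∈ Icc R s, t ^ (2 * γ) * v t ^ 2 = (t ^ (α + 1) * |y t|) ^ (2 * (p - 1)) := by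
    intro t ht
    have ht0 : 0 ≤ t := by linarith [ht.1]
    have h1 : (v t) ^ 2 = |y t| ^ (2 * (p - 1)) := by
      rw [← sq_abs, hv, abs_phiP hp, ← Real.rpow_mul_natCast (abs_nonneg _)]
      push_cast
      ring_nf
    rw [Real.mul_rpow (by positivity) (abs_nonneg _), ← Real.rpow_mul ht0, h1, hγ]
    ring_nf
  have hder : HasDerivAt (fun t => t ^ (2 * γ) * v t ^ 2)
      (2 * s ^ (2 * γ) * (γ * v s ^ 2 / s + v s *
        (-(n / s * v s) - s * y s - (α * w s + phiP (q + 1) (w s))))) s := by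
    refine ((Real.hasDerivAt_rpow_const (p := 2 * γ) (Or.inl hs0.ne')).mul
      ((h.hasDerivAt_flux s hs0).pow 2)).congr_deriv ?_
    rw [Real.rpow_sub_one hs0.ne']
    simp only [Pi.pow_apply, hv]
    push_cast
    field_simp
  have hnn := deriv_nonneg_of_forall_le_left hRs hder fun t ht => by
    rw [heq t ht, heq s ⟨hRs.le, le_rfl⟩]
    have ht0 : 0 ≤ t := by linarith [ht.1]
    exact Real.rpow_le_rpow (by positivity) (hmax ⟨ht.1, ht.2.trans hs.2⟩) (by positivity)
  have hnn := nonneg_of_mul_nonneg_right hnn (by positivity)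
  have hvy : v s * y s = |v s| * |y s| := by
    rw [← abs_mul, abs_of_nonneg (phiP_mul_self_nonneg p (y s))]
  have hle : s * |y s| ≤ γ * |v s| / s + C * |w s| := by
    rcases eq_or_ne (v s) 0 with h0 | h0
    · have : y s = 0 := (phiP_strictMono hp).injective (by rw [phiP_zero]; exact h0)
      rw [this, abs_zero, mul_zero]
      have hγ0 : 0 ≤ γ := by positivity
      positivity
    · have hv0 := abs_pos.2 h0
      refine le_of_mul_le_mul_left ?_ hv0
      have h1 : -(v s * (α * w s + phiP (q + 1) (w s))) ≤ |v s| * (C * |w s|) := by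
        refine (neg_le_abs _).trans ?_
        rw [abs_mul]
        gcongr
        exact hg s hs0.le
      have h2 : 0 ≤ n / s * v s ^ 2 := by positivity
      calc |v s| * (s * |y s|) = s * (v s * y s) := by rw [hvy]; ring
        _ ≤ γ * v s ^ 2 / s + |v s| * (C * |w s|) := by linarith
        _ = |v s| * (γ * |v s| / s + C * |w s|) := by rw [← sq_abs (v s)]; ring
  have hf := hflux s _ (y s) hs1 (hB s hs0.le) le_rfl
  set k := s ^ (α + 1) * |y s| with hk
  have hk0 : 0 ≤ k := by positivity
  have hγ0 : 0 ≤ γ := by positivity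
  have hk1 : k ≤ γ * (s ^ (α - 1) * |v s|) + C * (s ^ α * |w s|) := by
    have h1 : s ^ (α + 1) = s ^ α * s := Real.rpow_add_one hs0.ne' α
    have h2 : s ^ (α - 1) = s ^ α / s := Real.rpow_sub_one hs0.ne' α
    calc k = s ^ α * (s * |y s|) := by rw [hk, h1]; ring
      _ ≤ s ^ α * (γ * |v s| / s + C * |w s|) := by gcongr
      _ = _ := by rw [h2]; ring
  have hk2 : γ * (s ^ (α - 1) * |v s|) ≤ 1 / 2 * (k + 1) := by
    calc γ * (s ^ (α - 1) * |v s|) ≤ γ * (θ * R ^ (-η) * (k + 1)) := by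
          refine mul_le_mul_of_nonneg_left (hf.trans ?_) hγ0
          have : s ^ (-η) ≤ R ^ (-η) :=
            Real.rpow_le_rpow_of_nonpos (by linarith) hRs.le (by linarith)
          gcongr
      _ = γ * θ * R ^ (-η) * (k + 1) := by ring
      _ ≤ _ := by gcongr
  have hk3 : C * (s ^ α * |w s|) ≤ C * m := by gcongr; exact hm s hs
  have hBR : 0 ≤ B * R ^ (α + 1) := by positivity
  linarith

lemma hasDerivAt_weighted (h : RadialSolution n p q α a w y) {s : ℝ} (hs : 0 < s) :
    HasDerivAt (fun s => s ^ α * w s + s ^ (α - 1) * phiP p (y s))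
      (s ^ (α - 1) * ((α - (n + 1)) * (phiP p (y s) / s) - phiP (q + 1) (w s))) s := by
  refine (((Real.hasDerivAt_rpow_const (p := α) (Or.inl hs.ne')).mul (h.hasDerivAt s hs)).add
    ((Real.hasDerivAt_rpow_const (p := α - 1) (Or.inl hs.ne')).mul
      (h.hasDerivAt_flux s hs))).congr_deriv ?_
  rw [Real.rpow_sub_one hs.ne' (α - 1), Real.rpow_sub_one hs.ne' α]
  field_simp
  ring

lemma continuousOn_weighted (h : RadialSolution n p q α a w y) {R T : ℝ} (hR : 0 < R) :
    ContinuousOn (fun s => s ^ α * w s + s ^ (α - 1) * phiP p (y s)) (Icc R T) := fun _ hs =>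
  (h.hasDerivAt_weighted (hR.trans_le hs.1)).continuousAt.continuousWithinAt

lemma hasDerivAt_const_sub_rpow_neg {s : ℝ} (hs : 0 < s) (c d η : ℝ) :
    HasDerivAt (fun s : ℝ => c - d * s ^ (-η)) (d * η * (s ^ (-η) / s)) s := by
  refine (((Real.hasDerivAt_rpow_const (p := -η) (Or.inl hs.ne')).const_mul d).const_sub
    c).congr_deriv ?_
  rw [Real.rpow_sub_one hs.ne']
  ring

lemma weighted_le {R T B C k η θ G : ℝ} (hq : 1 < q) (hR : 1 ≤ R)
    (hk : 0 ≤ k) (hη : 0 < η) (hθ : 0 < θ) (h : RadialSolution n p q α a w y)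
    (hB : ∀ s, 0 ≤ s → |phiP p (y s)| ≤ B)
    (hg : ∀ x, |x| ≤ B → |phiP (q + 1) x| ≤ C * |x|)
    (hv : ∀ s ∈ Icc R T, s ^ (α - 1) * |phiP p (y s)| ≤ θ * s ^ (-η) * (k + 1)) (hC : 0 ≤ C)
    (hG : |R ^ α * w R + R ^ (α - 1) * phiP p (y R)| ≤ G) :
    ∀ s ∈ Icc R T, s ^ α * w s + s ^ (α - 1) * phiP p (y s) ≤
      G + ((|α - (n + 1)| + C) * θ + 1) / η * (k + 1) * R ^ (-η) := by
  have hR0 : 0 < R := by linarith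
  set A := ((|α - (n + 1)| + C) * θ + 1) / η with hA
  have hA0 : 0 < A := by positivity
  intro s hs
  have key := image_le_of_deriv_right_lt_deriv_boundary' (h.continuousOn_weighted (T := T) hR0)
    (fun s hs => (h.hasDerivAt_weighted (hR0.trans_le hs.1)).hasDerivWithinAt)
    (B := fun s => (G + A * (k + 1) * R ^ (-η)) - A * (k + 1) * s ^ (-η))
    (by linarith [le_abs_self (R ^ α * w R + R ^ (α - 1) * phiP p (y R))])
    (fun s hs => (hasDerivAt_const_sub_rpow_neg (hR0.trans_le hs.1)
      _ _ η).continuousAt.continuousWithinAt)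
    (fun s hs => (hasDerivAt_const_sub_rpow_neg (hR0.trans_le hs.1) _ _ η).hasDerivWithinAt)
    (fun s hs heq => ?_) hs
  · have : 0 ≤ A * (k + 1) * s ^ (-η) := by
      have := hR0.trans_le hs.1
      positivity
    linarith
  · have hs0 : 0 < s := hR0.trans_le hs.1
    set v := phiP p (y s) with hvs
    have hpos : 0 ≤ s ^ α * w s + s ^ (α - 1) * v := by
      rw [heq]
      have h1 : s ^ (-η) ≤ R ^ (-η) :=
        Real.rpow_le_rpow_of_nonpos hR0 hs.1 (by linarith)
      have h2 : A * (k + 1) * s ^ (-η) ≤ A * (k + 1) * R ^ (-η) := by gcongr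
      linarith [(abs_nonneg _).trans hG]
    have hw : -(v / s) ≤ w s := by
      rw [show s ^ α * w s + s ^ (α - 1) * v = s ^ α * (w s + v / s) by
        rw [Real.rpow_sub_one hs0.ne']; ring] at hpos
      linarith [nonneg_of_mul_nonneg_right hpos (by positivity)]
    have hf : -(C * (|v| / s)) ≤ phiP (q + 1) (w s) := by
      have h1 := (phiP_strictMono (show 1 < q + 1 by linarith)).monotone hw
      have h2 : |v / s| = |v| / s := by rw [abs_div, abs_of_pos hs0]
      have h3 : |v / s| ≤ B := by
        rw [h2]
        exact (div_le_self (abs_nonneg v) (hR.trans hs.1)).trans (hB s hs0.le)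
      have h4 := hg _ h3
      rw [phiP_neg] at h1
      rw [h2] at h4
      linarith [(abs_le.1 h4).2]
    calc s ^ (α - 1) * ((α - (n + 1)) * (v / s) - phiP (q + 1) (w s))
        ≤ s ^ (α - 1) * (|α - (n + 1)| * (|v| / s) + C * (|v| / s)) := by
          gcongr
          have : (α - (n + 1)) * (v / s) ≤ |α - (n + 1)| * (|v| / s) := by
            refine (le_abs_self _).trans_eq ?_
            rw [abs_mul, abs_div, abs_of_pos hs0]
          linarith
      _ = (|α - (n + 1)| + C) * (s ^ (α - 1) * |v|) / s := by ring
      _ ≤ (|α - (n + 1)| + C) * (θ * s ^ (-η) * (k + 1)) / s := by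
          exact div_le_div_of_nonneg_right (mul_le_mul_of_nonneg_left (hv s ⟨hs.1, hs.2.le⟩)
            (by positivity)) hs0.le
      _ = ((|α - (n + 1)| + C) * θ) * ((k + 1) * (s ^ (-η) / s)) := by ring
      _ < ((|α - (n + 1)| + C) * θ + 1) * ((k + 1) * (s ^ (-η) / s)) := by
          gcongr
          linarith
      _ = A * (k + 1) * η * (s ^ (-η) / s) := by rw [hA]; field_simp

lemma weighted_le_of_bounds {R T B C k η θ : ℝ} (hq : 1 < q) (hR : 1 ≤ R) (hk : 0 ≤ k)
    (hC : 0 ≤ C) (hη : 0 < η) (hθ : 0 < θ)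
    (h : RadialSolution n p q α a w y)
    (hw : ∀ s, 0 ≤ s → |w s| ≤ B) (hB : ∀ s, 0 ≤ s → |phiP p (y s)| ≤ B)
    (hg : ∀ x, |x| ≤ B → |phiP (q + 1) x| ≤ C * |x|)
    (hv : ∀ s ∈ Icc R T, s ^ (α - 1) * |phiP p (y s)| ≤ θ * s ^ (-η) * (k + 1))
    {s : ℝ} (hs : s ∈ Icc R T) :
    s ^ α * |w s| ≤ (R ^ α + R ^ (α - 1)) * B +
      (((|α - (n + 1)| + C) * θ + 1) / η + θ) * (k + 1) * R ^ (-η) := by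
  have hR0 : 0 < R := by linarith
  have hs0 : 0 < s := hR0.trans_le hs.1
  have hG : |R ^ α * w R + R ^ (α - 1) * phiP p (y R)| ≤ (R ^ α + R ^ (α - 1)) * B := by
    refine (abs_add_le _ _).trans ?_
    rw [abs_mul, abs_mul, abs_of_pos (show 0 < R ^ α by positivity),
      abs_of_pos (show 0 < R ^ (α - 1) by positivity), add_mul]
    gcongr
    exacts [hw R hR0.le, hB R hR0.le]
  have h1 := h.weighted_le hq hR hk hη hθ hB hg hv hC hG s hs
  have h2 := h.neg.weighted_le (G := (R ^ α + R ^ (α - 1)) * B) hq hR hk hη hθ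
    (by simpa only [phiP_neg, abs_neg] using hB) hg
    (by simpa only [phiP_neg, abs_neg] using hv) hC (by
      rwa [phiP_neg, mul_neg, mul_neg, ← neg_add, abs_neg]) s hs
  have h3 := hv s hs
  have h4 : θ * s ^ (-η) * (k + 1) ≤ θ * (k + 1) * R ^ (-η) := by
    rw [mul_right_comm]
    exact mul_le_mul_of_nonneg_left
      (Real.rpow_le_rpow_of_nonpos hR0 hs.1 (by linarith)) (by positivity)
  have h5 : |s ^ (α - 1) * phiP p (y s)| ≤ θ * (k + 1) * R ^ (-η) := by
    rw [abs_mul, abs_of_pos (show 0 < s ^ (α - 1) by positivity)]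
    exact h3.trans h4
  rw [phiP_neg] at h2
  rw [← abs_of_pos (show 0 < s ^ α by positivity), ← abs_mul]
  rw [abs_le] at h5 ⊢
  constructor <;> linarith

lemma exists_forall_decay (n : ℕ) (hp : 1 < p) (hq : 1 < q) (hα : 0 < α)
    (hL : 2 < p ∨ (p < 2 ∧ α < p / (2 - p))) (A : ℝ) :
    ∃ R M η : ℝ, 1 ≤ R ∧ 0 ≤ M ∧ 0 < η ∧ ∀ a w y, |a| ≤ A → RadialSolution n p q α a w y →
      ∀ s, R ≤ s → s ^ α * |w s| ≤ M ∧ s ^ (α - 1) * |phiP p (y s)| ≤ M * s ^ (-η) := by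
  obtain ⟨B, hB1, hB⟩ := exists_forall_bound n hp hq hα A
  obtain ⟨η, θ, hη, hθ, hflux⟩ := exists_flux_decay hp hL hB1
  set B' := B ^ (p - 1) + B with hB'
  have hB'0 : 0 ≤ B' := by positivity
  obtain ⟨C, hC, hg⟩ : ∃ C, 0 ≤ C ∧ ∀ x, |x| ≤ B' → |phiP (q + 1) x| ≤ C * |x| :=
    ⟨(q + 1 - 1) * B' ^ (q + 1 - 2), mul_nonneg (by linarith) (by positivity), fun x hx => by
      simpa [phiP_zero] using
        abs_phiP_sub_le (show 2 < q + 1 by linarith) hx (y := 0) (by simpa using hB'0)⟩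
  set K := ((|α - (n + 1)| + C) * θ + 1) / η + θ with hK
  have hK0 : 0 < K := by positivity
  have hlim : ∀ c : ℝ, ∀ᶠ R in atTop, c * R ^ (-η) ≤ 1 / 2 := fun c => by
    have := (tendsto_rpow_neg_atTop hη).const_mul c
    rw [mul_zero] at this
    exact this.eventually_le_const (by norm_num)
  obtain ⟨R, hR, hRθ, hRK⟩ := ((eventually_ge_atTop 1).and ((hlim ((α + 1) * (p - 1) * θ)).and
    (hlim (K * (2 * (α + C)))))).exists
  have hR0 : 0 < R := by linarith
  have hRη : R ^ (-η) ≤ 1 := Real.rpow_le_one_of_one_le_of_nonpos hR (by linarith)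
  set D := B * R ^ (α + 1) + 1 with hD
  have hD0 : 0 ≤ D := by positivity
  set m₀ := 2 * ((R ^ α + R ^ (α - 1)) * B' + K * (D + 1)) with hm₀
  have hm₀0 : 0 ≤ m₀ := by positivity
  refine ⟨R, m₀ + θ * (2 * (α + C) * m₀ + D + 1), η, hR, by positivity, hη,
    fun a w y ha h => ?_⟩
  have hw := fun s hs => (hB a w y ha h s hs).1
  have hy := fun s hs => (hB a w y ha h s hs).2
  have hw' : ∀ s, 0 ≤ s → |w s| ≤ B' := fun s hs =>
    (hw s hs).trans (le_add_of_nonneg_left (by positivity))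
  have hv' : ∀ s, 0 ≤ s → |phiP p (y s)| ≤ B' := fun s hs => by
    rw [abs_phiP hp]
    exact (Real.rpow_le_rpow (abs_nonneg _) (hy s hs) (by linarith)).trans
      (le_add_of_nonneg_right (by positivity))
  have hgw : ∀ s, 0 ≤ s → |α * w s + phiP (q + 1) (w s)| ≤ (α + C) * |w s| := fun s hs => by
    refine (abs_add_le _ _).trans ?_
    rw [abs_mul, abs_of_pos hα, add_mul]
    gcongr
    exact hg _ (hw' s hs)
  have hkey : ∀ T, R ≤ T → T ^ α * |w T| ≤ m₀ := by
    intro T hRT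
    have hcont : ContinuousOn (fun s => s ^ α * |w s|) (Icc R T) :=
      ((continuous_id.rpow_const fun _ => Or.inr hα.le).continuousOn).mul
        (h.cont.mono fun s hs => hR0.le.trans hs.1).abs
    obtain ⟨s₀, hs₀, hmax⟩ := isCompact_Icc.exists_isMaxOn (nonempty_Icc.2 hRT) hcont
    obtain ⟨m, hm⟩ : ∃ m, s₀ ^ α * |w s₀| = m := ⟨_, rfl⟩
    have hs₀0 : 0 < s₀ := hR0.trans_le hs₀.1
    have hm0 : 0 ≤ m := hm ▸ by positivity
    have hmm : ∀ s ∈ Icc R T, s ^ α * |w s| ≤ m := fun s hs => (hmax hs).trans_eq hm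
    have hyk := h.weighted_deriv_le hp hα hR (by positivity) hη hθ hy hgw hflux hRθ hmm
    have := h.weighted_le_of_bounds hq hR (k := 2 * (α + C) * m + D) (by positivity)
      hC hη hθ hw' hv' hg
      (fun s hs => hflux s _ (y s) (hR.trans hs.1) (hy s (hR0.le.trans hs.1))
        ((hyk s hs).trans_eq (by rw [hD]; ring))) hs₀
    have h1 : K * (2 * (α + C)) * R ^ (-η) * m ≤ 1 / 2 * m := by gcongr
    have h2 : K * (D + 1) * R ^ (-η) ≤ K * (D + 1) := mul_le_of_le_one_right (by positivity) hRη
    refine (hmm T ⟨hRT, le_rfl⟩).trans ?_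
    rw [← hK, hm, show K * (2 * (α + C) * m + D + 1) * R ^ (-η)
      = K * (2 * (α + C)) * R ^ (-η) * m + K * (D + 1) * R ^ (-η) by ring] at this
    linarith
  refine fun s hs => ⟨(hkey s hs).trans (le_add_of_nonneg_right (by positivity)), ?_⟩
  have hyk := h.weighted_deriv_le hp hα hR (by positivity) hη hθ hy hgw hflux hRθ
    (T := s) (m := m₀) (fun t ht => hkey t ht.1) s ⟨hs, le_rfl⟩
  have hs0 : 0 < s := hR0.trans_le hs
  calc s ^ (α - 1) * |phiP p (y s)|
      ≤ θ * s ^ (-η) * (2 * (α + C) * m₀ + D + 1) :=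
        hflux s _ (y s) (hR.trans hs) (hy s hs0.le) (hyk.trans_eq (by rw [hD]; ring))
    _ = θ * (2 * (α + C) * m₀ + D + 1) * s ^ (-η) := by ring
    _ ≤ _ := by
        gcongr
        linarith

lemma exists_forall_tail (n : ℕ) (hp : 1 < p) (hq : 1 < q) (hα : 0 < α)
    (hL : 2 < p ∨ (p < 2 ∧ α < p / (2 - p))) (A : ℝ) :
    ∃ R C κ : ℝ, 1 ≤ R ∧ 0 < κ ∧ ∀ a w y, |a| ≤ A → RadialSolution n p q α a w y →
      ∀ r s, R ≤ r → r ≤ s → |s ^ α * w s - r ^ α * w r| ≤ C * r ^ (-κ) := by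
  obtain ⟨R, M, η, hR, hM, hη, hdecay⟩ := exists_forall_decay n hp hq hα hL A
  have hκ : 0 < min η (α * (q - 1)) := lt_min hη (mul_pos hα (by linarith))
  set κ := min η (α * (q - 1)) with hκdef
  set D := (|α - (n + 1)| * M + M ^ q) / κ with hD
  have hD0 : 0 ≤ D := by positivity
  refine ⟨R, D + 2 * M, κ, hR, hκ, fun a w y ha h r s hr hrs => ?_⟩
  have hr0 : 0 < r := by linarith
  have hs0 : 0 < s := hr0.trans_le hrs
  have hdec := hdecay a w y ha h
  have hmono : ∀ t, R ≤ t → ∀ σ, κ ≤ σ → t ^ (-σ) ≤ t ^ (-κ) := fun t ht σ hσ =>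
    Real.rpow_le_rpow_of_exponent_le (hR.trans ht) (by linarith)
  have hflux : ∀ t, r ≤ t → |t ^ (α - 1) * phiP p (y t)| ≤ M * r ^ (-κ) := fun t ht => by
    have ht0 : 0 < t := hr0.trans_le ht
    rw [abs_mul, abs_of_pos (show 0 < t ^ (α - 1) by positivity)]
    refine (hdec t (hr.trans ht)).2.trans (mul_le_mul_of_nonneg_left ?_ hM)
    exact (hmono t (hr.trans ht) η (min_le_left _ _)).trans
      (Real.rpow_le_rpow_of_nonpos hr0 ht (by linarith))
  have hG := abs_sub_le_of_abs_deriv_le hrs (h.continuousOn_weighted (T := s) hr0)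
    (fun t ht => (hasDerivAt_const_sub_rpow_neg (hr0.trans_le ht.1)
      0 D κ).continuousAt.continuousWithinAt)
    (fun t ht => h.hasDerivAt_weighted (hr0.trans ht.1))
    (fun t ht => hasDerivAt_const_sub_rpow_neg (hr0.trans ht.1) 0 D κ)
    (fun t ht => ?_)
  · have h1 := hflux r le_rfl
    have h2 := hflux s hrs
    have h3 : 0 ≤ D * s ^ (-κ) := by positivity
    rw [abs_le] at h1 h2 hG ⊢
    constructor <;> linarith
  · have hrt := ht.1.le
    have ht0 : 0 < t := hr0.trans ht.1
    obtain ⟨hwt, hvt⟩ := hdec t (hr.trans hrt)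
    have h1 : t ^ (α - 1) * |(α - (n + 1)) * (phiP p (y t) / t)| ≤
        |α - (n + 1)| * M * (t ^ (-κ) / t) := by
      rw [abs_mul, abs_div, abs_of_pos ht0]
      calc t ^ (α - 1) * (|α - (n + 1)| * (|phiP p (y t)| / t))
          = |α - (n + 1)| * ((t ^ (α - 1) * |phiP p (y t)|) / t) := by ring
        _ ≤ |α - (n + 1)| * (M * t ^ (-κ) / t) := by
            refine mul_le_mul_of_nonneg_left (div_le_div_of_nonneg_right (hvt.trans ?_) ht0.le)
              (abs_nonneg _)
            exact mul_le_mul_of_nonneg_left (hmono t (hr.trans hrt) η (min_le_left _ _)) hM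
        _ = _ := by ring
    have h2 : t ^ (α - 1) * |phiP (q + 1) (w t)| ≤ M ^ q * (t ^ (-κ) / t) := by
      rw [abs_phiP (by linarith), add_sub_cancel_right]
      calc t ^ (α - 1) * |w t| ^ q = (t ^ α * |w t|) ^ q * (t ^ (-(α * (q - 1))) / t) := by
            rw [Real.mul_rpow (by positivity) (abs_nonneg _), ← Real.rpow_mul ht0.le,
              ← Real.rpow_sub_one ht0.ne', mul_right_comm, ← Real.rpow_add ht0]
            ring_nf
        _ ≤ M ^ q * (t ^ (-κ) / t) := by
            have := hmono t (hr.trans hrt) _ (min_le_right η (α * (q - 1)))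
            gcongr
    rw [abs_mul, abs_of_pos (show 0 < t ^ (α - 1) by positivity)]
    calc t ^ (α - 1) * |(α - (n + 1)) * (phiP p (y t) / t) - phiP (q + 1) (w t)|
        ≤ t ^ (α - 1) * (|(α - (n + 1)) * (phiP p (y t) / t)| + |phiP (q + 1) (w t)|) := by
          gcongr
          exact abs_sub _ _
      _ ≤ (|α - (n + 1)| * M + M ^ q) * (t ^ (-κ) / t) := by linarith
      _ = D * κ * (t ^ (-κ) / t) := by rw [hD, div_mul_cancel₀ _ hκ.ne']

/-- Continuous dependence on the initial value for the profile `s ^ α * w s`, uniformly in `s`. -/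
theorem eventually_forall_abs_rpow_mul_sub_le {w y : ℝ → ℝ → ℝ} (hp : 1 < p) (hq : 1 < q)
    (hα : 0 < α) (hL : 2 < p ∨ (p < 2 ∧ α < p / (2 - p)))
    (h : ∀ a, RadialSolution n p q α a (w a) (y a)) (a : ℝ) {ε : ℝ} (hε : 0 < ε) :
    ∀ᶠ b in 𝓝 a, ∀ s, 0 ≤ s → (1 + s) ^ α * |w a s - w b s| ≤ ε := by
  obtain ⟨R, C, κ, hR, hκ, htail⟩ := exists_forall_tail n hp hq hα hL (|a| + 1)
  set δ := ε / (3 * 2 ^ α) with hδ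
  have hδ0 : 0 < δ := by positivity
  have hlim : ∀ᶠ r in atTop, C * r ^ (-κ) ≤ δ := by
    have := (tendsto_rpow_neg_atTop hκ).const_mul C
    rw [mul_zero] at this
    exact this.eventually_le_const hδ0
  obtain ⟨r, hRr, hr⟩ := ((eventually_ge_atTop R).and hlim).exists
  have hr0 : 0 < r := by linarith
  have hab : ∀ᶠ b in 𝓝 a, |b| ≤ |a| + 1 :=
    (continuous_abs.tendsto a).eventually_le_const (by linarith)
  have h1r : 0 < (1 + r) ^ α := by positivity
  filter_upwards [hab, eventually_forall_abs_sub_le hp hq hα h a hr0.le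
    (show 0 < δ / (1 + r) ^ α by positivity)] with b hb hloc s hs
  have h2 : (1 : ℝ) ≤ 2 ^ α := Real.one_le_rpow one_le_two hα.le
  have hδε : 2 ^ α * (3 * δ) = ε := by rw [hδ]; field_simp
  have hcmp : ∀ t, 0 ≤ t → t ≤ r → (1 + t) ^ α * |w a t - w b t| ≤ δ := fun t ht htr =>
    calc (1 + t) ^ α * |w a t - w b t| ≤ (1 + r) ^ α * (δ / (1 + r) ^ α) := by
          gcongr
          exact hloc t ⟨ht, htr⟩
      _ = δ := by field_simp
  rcases le_total s r with hsr | hrs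
  · refine (hcmp s hs hsr).trans ?_
    nlinarith
  · have hs1 : 1 ≤ s := by linarith
    have ha := (htail a _ _ (by linarith) (h a) r s hRr hrs).trans hr
    have hb := (htail b _ _ hb (h b) r s hRr hrs).trans hr
    have hab : |r ^ α * w a r - r ^ α * w b r| ≤ δ := by
      rw [← mul_sub, abs_mul, abs_of_pos (show 0 < r ^ α by positivity)]
      refine le_trans ?_ (hcmp r hr0.le le_rfl)
      gcongr
      linarith
    calc (1 + s) ^ α * |w a s - w b s| ≤ (2 * s) ^ α * |w a s - w b s| := by
          gcongr
          linarith
      _ = 2 ^ α * |s ^ α * w a s - s ^ α * w b s| := by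
          rw [Real.mul_rpow two_pos.le hs, ← mul_sub, abs_mul,
            abs_of_nonneg (show 0 ≤ s ^ α by positivity)]
          ring
      _ ≤ 2 ^ α * (3 * δ) := by
          gcongr
          rw [abs_le] at *
          constructor <;> linarith
      _ = ε := hδε

end RadialSolution

/-- Assume (L). The function `a ↦ L(a) = lim_{r→∞} r^α w(r,a)` is continuous on `ℝ`,
and the family `a ↦ (1+r)^α w(r,a)` (indexed by `r ≥ 0`) is equicontinuous on `ℝ`. -/
theorem stmt12 (N : ℕ) (hN : 1 ≤ N) (p q α : ℝ) (hp : 1 < p) (hq : 1 < q) (hα : 0 < α)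
    (hL : 2 < p ∨ (p < 2 ∧ α < p / (2 - p)))
    (W : ℝ → ℝ → ℝ) (hW : ∀ a : ℝ, IsGlobalSolution N p q α a (W a))
    (L : ℝ → ℝ)
    (hLdef : ∀ a : ℝ, Tendsto (fun r => r ^ α * W a r) atTop (𝓝 (L a))) :
    Continuous L ∧
    Equicontinuous (fun r : Ici (0 : ℝ) => fun a : ℝ => (1 + (r : ℝ)) ^ α * W a (r : ℝ)) := by
  obtain ⟨n, rfl⟩ := Nat.exists_eq_add_of_le' hN
  have hkey := fun a ε (hε : (0 : ℝ) < ε) =>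
    RadialSolution.eventually_forall_abs_rpow_mul_sub_le hp hq hα hL
      (fun a => (hW a).radialSolution) a hε
  refine ⟨Metric.continuous_iff'.2 fun a ε hε => ?_, fun a => ?_⟩
  · filter_upwards [hkey a (ε / 2) (half_pos hε)] with b hb
    rw [dist_comm, Real.dist_eq]
    refine lt_of_le_of_lt ?_ (half_lt_self hε)
    refine le_of_tendsto ((hLdef a).sub (hLdef b)).abs ?_
    filter_upwards [eventually_ge_atTop 0] with r hr
    rw [← mul_sub, abs_mul, abs_of_nonneg (Real.rpow_nonneg hr α)]
    refine le_trans ?_ (hb r hr)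
    gcongr
    linarith
  · refine Metric.equicontinuousAt_iff_right.2 fun ε hε => ?_
    filter_upwards [hkey a (ε / 2) (half_pos hε)] with b hb r
    have hr : (0 : ℝ) ≤ r := r.2
    rw [Real.dist_eq, ← mul_sub, abs_mul, abs_of_nonneg (by positivity)]
    exact (hb r hr).trans_lt (half_lt_self hε)
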